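/- Fix unit vectors u, v ∈ ℝ² with u + v ≠ 0 and c ∈ ℝ², with weight w(s,t) = ‖c + s·u − t·v‖. Let a = (a1,a2), b = (b1,b2) ∈ ℝ² with a1 ≤ b1 and a2 ≤ b2, let R = [a1,b1] × [a2,b2], and let L = {(s,t) : ⟨c + s·u − t·v, u + v⟩ = 0} be the monotone free-space axis. Suppose L ∩ R is nonempty, and let c1 and c2 be its componentwise least and greatest points (so c1 ≤ c2 componentwise since L has direction (1,1)). Let π be a constant-speed Lipschitz parametrization of the polyline a → c1 → c2 → b. Then for every monotone Lipschitz path ψ : [0,1] → ℝ² with ψ(0) = a and ψ(1) = b, the weighted length of π is at most that of ψ: ∫ w(π(t))·‖π'(t)‖₁ dt ≤ ∫ w(ψ(t))·‖ψ'(t)‖₁ dt. -/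

import Mathlib

open scoped InnerProductSpace
open MeasureTheory

/-- The L1 distance on the parameter plane. -/
noncomputable def d1 (p q : ℝ × ℝ) : ℝ := |p.1 - q.1| + |p.2 - q.2|

/-- The constant-speed (w.r.t. the L1 norm) parametrization of the
polyline `a → c1 → c2 → b`, on the time interval `[0,1]`. -/
noncomputable def polyPath (a c1 c2 b : ℝ × ℝ) (t : ℝ) : ℝ × ℝ :=
  let l1 := d1 a c1
  let l2 := d1 c1 c2
  let l3 := d1 c2 b
  let L := l1 + l2 + l3
  if t * L ≤ l1 then a + (t * L / l1) • (c1 - a)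
  else if t * L ≤ l1 + l2 then c1 + ((t * L - l1) / l2) • (c2 - c1)
  else c2 + ((t * L - l1 - l2) / l3) • (b - c2)

/-- On a line of constant coordinate sum, the leash length increases with the distance
of `s - t` from its value `y₀` on the monotone axis. -/
lemma norm_leash_le_of_abs_le {E : Type*} [NormedAddCommGroup E] [InnerProductSpace ℝ E]
    {u v c : E} {y₀ η : ℝ} (hη : 0 ≤ η) (hnorm : ‖u + v‖ ^ 2 = 2 * η)
    (hinner : ∀ p : ℝ × ℝ, ⟪c + p.1 • u - p.2 • v, u + v⟫_ℝ = η * (p.1 - p.2 - y₀))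
    {p q : ℝ × ℝ} (hsum : p.1 + p.2 = q.1 + q.2)
    (hle : |p.1 - p.2 - y₀| ≤ |q.1 - q.2 - y₀|) :
    ‖c + p.1 • u - p.2 • v‖ ≤ ‖c + q.1 • u - q.2 • v‖ := by
  have hq : c + q.1 • u - q.2 • v = (c + p.1 • u - p.2 • v) + (q.1 - p.1) • (u + v) := by
    rw [show q.2 = p.2 - (q.1 - p.1) by linarith]
    module
  have hsq := sq_le_sq.2 hle
  refine le_of_sq_le_sq ?_ (norm_nonneg _)
  rw [hq, norm_add_sq_real, inner_smul_right, hinner, norm_smul, mul_pow, hnorm,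
    Real.norm_eq_abs, sq_abs]
  rw [show q.2 = p.2 - (q.1 - p.1) by linarith] at hsq
  nlinarith [mul_le_mul_of_nonneg_left hsq hη]

/-- Integration by substitution along a Lipschitz function. -/
lemma integral_comp_mul_deriv_of_lipschitzWith {m x : ℝ → ℝ} (hm : Continuous m) {K : NNReal}
    (hx : LipschitzWith K x) (a b : ℝ) :
    ∫ t in a..b, m (x t) * deriv x t = ∫ y in x a..x b, m y := by
  let M : ℝ → ℝ := fun y => ∫ z in x a..y, m z
  have hM : ∀ y, HasDerivAt M (m y) y := fun y => hm.integral_hasStrictDerivAt _ _ |>.hasDerivAt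
  have hMd : ContDiff ℝ 1 M := by
    rw [contDiff_one_iff_deriv]
    refine ⟨fun y => (hM y).differentiableAt, ?_⟩
    rwa [show deriv M = m from funext fun y => (hM y).deriv]
  have hc : IsCompact (x '' Set.uIcc a b) := isCompact_uIcc.image hx.continuous
  have hconv : Convex ℝ (x '' Set.uIcc a b) :=
    (isPreconnected_uIcc.image x hx.continuous.continuousOn).ordConnected.convex
  obtain ⟨C, hC⟩ := hMd.contDiffOn.exists_lipschitzOnWith one_ne_zero hconv hc
  have hac : AbsolutelyContinuousOnInterval (M ∘ x) a b :=
    (hC.comp hx.lipschitzOnWith (Set.mapsTo_image _ _)).absolutelyContinuousOnInterval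
  have h := hac.integral_deriv_eq_sub
  have h0 : M (x a) = 0 := intervalIntegral.integral_same
  rw [Function.comp_apply, Function.comp_apply, h0, sub_zero] at h
  rw [← show M (x b) = ∫ y in x a..x b, m y from rfl, ← h]
  refine intervalIntegral.integral_congr_ae ?_
  filter_upwards [hx.ae_differentiableAt_real] with t ht _
  exact ((hM (x t)).comp t ht.hasDerivAt).deriv.symm

/-- Comparison of interval integrals of nonnegative functions, of which only the larger one
has to be integrable. -/
lemma integral_mono_of_ae_Ioo {f g : ℝ → ℝ} {a b : ℝ} (hab : a ≤ b)
    (hg : IntervalIntegrable g volume a b)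
    (h : ∀ᵐ t, t ∈ Set.Ioo a b → 0 ≤ f t ∧ f t ≤ g t) :
    ∫ t in a..b, f t ≤ ∫ t in a..b, g t := by
  rw [intervalIntegral.integral_of_le hab, intervalIntegral.integral_of_le hab,
    integral_Ioc_eq_integral_Ioo, integral_Ioc_eq_integral_Ioo]
  rw [intervalIntegrable_iff_integrableOn_Ioo_of_le hab] at hg
  have h' := (ae_restrict_iff' measurableSet_Ioo).2 h
  exact integral_mono_of_nonneg (h'.mono fun _ ht => ht.1) hg (h'.mono fun _ ht => ht.2)

/-- The `L¹` speed of a Lipschitz monotone path is the derivative of its coordinate sum. -/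
lemma ae_abs_deriv_add_abs_deriv_eq {ψ : ℝ → ℝ × ℝ} {K : NNReal} (hψ : LipschitzWith K ψ)
    {a b : ℝ} (hm1 : MonotoneOn (fun t => (ψ t).1) (Set.Icc a b))
    (hm2 : MonotoneOn (fun t => (ψ t).2) (Set.Icc a b)) :
    ∀ᵐ t, t ∈ Set.Ioo a b →
      |(deriv ψ t).1| + |(deriv ψ t).2| = deriv (fun t => (ψ t).1 + (ψ t).2) t ∧
      0 ≤ deriv (fun t => (ψ t).1 + (ψ t).2) t := by
  filter_upwards [hψ.ae_differentiableAt_real] with t ht hmem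
  have hnhds : Set.Icc a b ∈ nhds t := Icc_mem_nhds hmem.1 hmem.2
  have h1 : HasDerivAt (fun t => (ψ t).1) (deriv ψ t).1 t := ht.hasDerivAt.fst
  have h2 : HasDerivAt (fun t => (ψ t).2) (deriv ψ t).2 t := ht.hasDerivAt.snd
  have p1 : 0 ≤ (deriv ψ t).1 := by
    rw [← h1.deriv, ← derivWithin_of_mem_nhds hnhds]
    exact hm1.derivWithin_nonneg
  have p2 : 0 ≤ (deriv ψ t).2 := by
    rw [← h2.deriv, ← derivWithin_of_mem_nhds hnhds]
    exact hm2.derivWithin_nonneg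
  rw [(h1.fun_add h2).deriv, abs_of_nonneg p1, abs_of_nonneg p2]
  exact ⟨rfl, add_nonneg p1 p2⟩

lemma d1_nonneg (p q : ℝ × ℝ) : 0 ≤ d1 p q := add_nonneg (abs_nonneg _) (abs_nonneg _)

lemma d1_of_le {p q : ℝ × ℝ} (h : p ≤ q) : d1 p q = (q.1 + q.2) - (p.1 + p.2) := by
  rw [d1, abs_sub_comm, abs_of_nonneg (sub_nonneg.2 h.1), abs_sub_comm,
    abs_of_nonneg (sub_nonneg.2 h.2)]
  ring

/-- A segment traversed with `L¹` speed `l`. -/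
lemma abs_deriv_add_abs_deriv_eq_of_eventuallyEq {f : ℝ → ℝ × ℝ} {p q r : ℝ × ℝ} {l k t : ℝ}
    (hl : 0 ≤ l) (hpq : 0 < d1 p q)
    (hf : f =ᶠ[nhds t] fun s => r + ((s * l - k) / d1 p q) • (q - p)) :
    |(deriv f t).1| + |(deriv f t).2| = l := by
  have h : HasDerivAt (fun s => r + ((s * l - k) / d1 p q) • (q - p))
      ((1 * l / d1 p q) • (q - p)) t :=
    (((((hasDerivAt_id t).mul_const l).sub_const k).div_const _).smul_const _).const_add _
  rw [hf.deriv_eq, h.deriv]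
  have hd : |q.1 - p.1| + |q.2 - p.2| = d1 p q := by
    rw [d1, abs_sub_comm q.1, abs_sub_comm q.2]
  rw [Prod.smul_fst, Prod.smul_snd, smul_eq_mul, smul_eq_mul, abs_mul, abs_mul, ← mul_add,
    Prod.fst_sub, Prod.snd_sub, hd, abs_of_nonneg (by positivity)]
  field_simp

/-- `polyPath` has constant `L¹` speed. -/
lemma ae_abs_deriv_polyPath (a c1 c2 b : ℝ × ℝ) :
    ∀ᵐ t, t ∈ Set.Ioo (0 : ℝ) 1 →
      |(deriv (polyPath a c1 c2 b) t).1| + |(deriv (polyPath a c1 c2 b) t).2|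
        = d1 a c1 + d1 c1 c2 + d1 c2 b := by
  set l := d1 a c1 + d1 c1 c2 + d1 c2 b with hl
  have n1 := d1_nonneg a c1
  have n2 := d1_nonneg c1 c2
  have n3 := d1_nonneg c2 b
  have hl0 : 0 ≤ l := by positivity
  rcases hl0.eq_or_lt with h0 | hpos
  · have hconst : polyPath a c1 c2 b = fun _ => a := by
      funext t
      have e1 : d1 a c1 = 0 := by linarith
      have e2 : d1 c1 c2 = 0 := by linarith
      have e3 : d1 c2 b = 0 := by linarith
      simp [polyPath, e1, e2, e3]
    simp [hconst, ← h0]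
  have ne1 : ∀ᵐ t : ℝ, t ≠ d1 a c1 / l := by simp [ae_iff, measure_singleton]
  have ne2 : ∀ᵐ t : ℝ, t ≠ (d1 a c1 + d1 c1 c2) / l := by simp [ae_iff, measure_singleton]
  filter_upwards [ne1, ne2] with t h1 h2 ht
  rw [Ne, eq_div_iff hpos.ne'] at h1 h2
  have hcont : Continuous fun s : ℝ => s * l := by fun_prop
  have ht0 : 0 < t * l := mul_pos ht.1 hpos
  have ht1 : t * l < l := by nlinarith [ht.2]
  rcases lt_or_gt_of_ne h1 with h1 | h1
  · refine abs_deriv_add_abs_deriv_eq_of_eventuallyEq (p := a) (q := c1) (r := a) (k := 0) hl0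
      (by linarith) ?_
    filter_upwards [hcont.continuousAt.eventually_lt_const h1] with s hs
    simp only [polyPath, ← hl, if_pos hs.le, sub_zero]
  rcases lt_or_gt_of_ne h2 with h2 | h2
  · refine abs_deriv_add_abs_deriv_eq_of_eventuallyEq (p := c1) (q := c2) (r := c1)
      (k := d1 a c1) hl0 (by linarith) ?_
    filter_upwards [hcont.continuousAt.eventually_lt_const h2,
      hcont.continuousAt.eventually_const_lt h1] with s hs hs'
    simp only [polyPath, ← hl, if_pos hs.le, if_neg hs'.not_ge]
  · refine abs_deriv_add_abs_deriv_eq_of_eventuallyEq (p := c2) (q := b) (r := c2)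
      (k := d1 a c1 + d1 c1 c2) hl0 (by linarith) ?_
    filter_upwards [hcont.continuousAt.eventually_const_lt h2,
      hcont.continuousAt.eventually_const_lt h1] with s hs hs'
    simp only [polyPath, ← hl, if_neg hs.not_ge, if_neg hs'.not_ge, sub_sub]

/-- The coordinate sum along an increasing segment, which may be trivial. -/
lemma segment_sum_eq {p q : ℝ × ℝ} (h : p ≤ q) {x : ℝ} (hx0 : 0 ≤ x) (hx : x ≤ d1 p q) :
    (p + (x / d1 p q) • (q - p)).1 + (p + (x / d1 p q) • (q - p)).2 = p.1 + p.2 + x := by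
  rcases (d1_nonneg p q).eq_or_lt with h0 | h0
  · have : x = 0 := by linarith
    simp [this]
  · have hd := d1_of_le h
    simp only [Prod.fst_add, Prod.snd_add, Prod.smul_fst, Prod.smul_snd, Prod.fst_sub,
      Prod.snd_sub, smul_eq_mul]
    calc _ = p.1 + p.2 + x / d1 p q * (q.1 + q.2 - (p.1 + p.2)) := by ring
      _ = _ := by rw [← hd]; field_simp

/-- The coordinate difference along a segment is interpolated affinely. -/
lemma segment_sub_eq (p q : ℝ × ℝ) (y r : ℝ) :
    (p + r • (q - p)).1 - (p + r • (q - p)).2 - y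
      = (1 - r) * (p.1 - p.2 - y) + r * (q.1 - q.2 - y) := by
  simp only [Prod.fst_add, Prod.snd_add, Prod.smul_fst, Prod.smul_snd, Prod.fst_sub,
    Prod.snd_sub, smul_eq_mul]
  ring

/-- The least distance of `s - t` from `y₀` over the points of coordinate sum `x` that lie
on monotone paths from `a` to `b`. -/
noncomputable def axisGap (a b : ℝ × ℝ) (y₀ x : ℝ) : ℝ :=
  max 0 (max (|a.1 - a.2 - y₀| - (x - (a.1 + a.2))) (|b.1 - b.2 - y₀| - (b.1 + b.2 - x)))

lemma axisGap_le {a b p : ℝ × ℝ} (y₀ : ℝ) (hap : a ≤ p) (hpb : p ≤ b) :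
    axisGap a b y₀ (p.1 + p.2) ≤ |p.1 - p.2 - y₀| := by
  obtain ⟨h1, h2⟩ := hap
  obtain ⟨h3, h4⟩ := hpb
  refine max_le (abs_nonneg _) (max_le ?_ ?_)
  · have := abs_sub_abs_le_abs_sub (a.1 - a.2 - y₀) (p.1 - p.2 - y₀)
    have : |(a.1 - a.2 - y₀) - (p.1 - p.2 - y₀)| ≤ p.1 + p.2 - (a.1 + a.2) :=
      abs_le.2 ⟨by linarith, by linarith⟩
    linarith
  · have := abs_sub_abs_le_abs_sub (b.1 - b.2 - y₀) (p.1 - p.2 - y₀)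
    have : |(b.1 - b.2 - y₀) - (p.1 - p.2 - y₀)| ≤ b.1 + b.2 - (p.1 + p.2) :=
      abs_le.2 ⟨by linarith, by linarith⟩
    linarith

/-- `polyPath` moves towards the axis as fast as possible, follows it, and leaves it as
late as possible. -/
lemma polyPath_sum_and_abs_le {a c1 c2 b : ℝ × ℝ} {y₀ : ℝ} (h1 : a ≤ c1) (h2 : c1 ≤ c2)
    (h3 : c2 ≤ b) (hc1 : c1.1 - c1.2 = y₀) (hc2 : c2.1 - c2.2 = y₀)
    (ha : |a.1 - a.2 - y₀| = d1 a c1) (hb : |b.1 - b.2 - y₀| = d1 c2 b)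
    {t : ℝ} (ht0 : 0 ≤ t) (ht1 : t ≤ 1) :
    (polyPath a c1 c2 b t).1 + (polyPath a c1 c2 b t).2
        = a.1 + a.2 + t * (b.1 + b.2 - (a.1 + a.2)) ∧
      |(polyPath a c1 c2 b t).1 - (polyPath a c1 c2 b t).2 - y₀|
        ≤ axisGap a b y₀ (a.1 + a.2 + t * (b.1 + b.2 - (a.1 + a.2))) := by
  have e1 := d1_of_le h1
  have e2 := d1_of_le h2
  have e3 := d1_of_le h3
  have n1 := d1_nonneg a c1
  have n2 := d1_nonneg c1 c2
  have n3 := d1_nonneg c2 b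
  have hl : d1 a c1 + d1 c1 c2 + d1 c2 b = b.1 + b.2 - (a.1 + a.2) := by linarith
  have hx0 : 0 ≤ t * (b.1 + b.2 - (a.1 + a.2)) := mul_nonneg ht0 (by linarith)
  have hx1 : t * (b.1 + b.2 - (a.1 + a.2)) ≤ d1 a c1 + d1 c1 c2 + d1 c2 b := by
    rw [hl]
    exact mul_le_of_le_one_left (by linarith) ht1
  simp only [polyPath, hl]
  generalize t * (b.1 + b.2 - (a.1 + a.2)) = x at hx0 hx1 ⊢
  have hgap0 : 0 ≤ axisGap a b y₀ (a.1 + a.2 + x) := le_max_left _ _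
  have hgapa : d1 a c1 - x ≤ axisGap a b y₀ (a.1 + a.2 + x) := by
    refine le_trans (le_of_eq ?_) ((le_max_left _ _).trans (le_max_right _ _))
    rw [ha]; ring
  have hgapb : x - d1 a c1 - d1 c1 c2 ≤ axisGap a b y₀ (a.1 + a.2 + x) := by
    refine le_trans (le_of_eq ?_) ((le_max_right _ _).trans (le_max_right _ _))
    rw [hb]; linarith
  split_ifs with i1 i2
  · refine ⟨segment_sum_eq h1 hx0 i1, ?_⟩
    rw [segment_sub_eq, hc1, sub_self, mul_zero, add_zero, abs_mul, ha,
      abs_of_nonneg (sub_nonneg.2 (div_le_one_of_le₀ i1 n1))]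
    refine le_trans (le_of_eq ?_) hgapa
    rcases n1.eq_or_lt with h0 | h0
    · rw [← h0]; linarith
    · field_simp
  · refine ⟨(segment_sum_eq h2 (by linarith) (by linarith)).trans (by linarith), ?_⟩
    rw [segment_sub_eq, hc1, hc2, sub_self]
    simpa using hgap0
  · refine ⟨(segment_sum_eq h3 (by linarith) (by linarith)).trans (by linarith), ?_⟩
    have hpos : 0 < d1 c2 b := by linarith
    rw [segment_sub_eq, hc2, sub_self, mul_zero, zero_add, abs_mul, hb,
      abs_of_nonneg (div_nonneg (by linarith) n3), div_mul_cancel₀ _ hpos.ne']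
    exact hgapb

/-- The least point of a diagonal line in a box lies on the lower boundary. -/
lemma abs_sub_eq_d1_of_least {a b c : ℝ × ℝ} {y₀ : ℝ} (hac : a ≤ c) (hcb : c ≤ b)
    (hc : c.1 - c.2 = y₀)
    (hmin : ∀ p : ℝ × ℝ, p.1 - p.2 = y₀ → a ≤ p → p ≤ b → c ≤ p) :
    |a.1 - a.2 - y₀| = d1 a c := by
  have hd := d1_of_le hac
  obtain ⟨h1, h2⟩ := hac
  have key : c.1 = a.1 ∨ c.2 = a.2 := by
    by_contra! hne
    have hε : 0 < min (c.1 - a.1) (c.2 - a.2) :=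
      lt_min (sub_pos.2 (lt_of_le_of_ne h1 hne.1.symm)) (sub_pos.2 (lt_of_le_of_ne h2 hne.2.symm))
    have hl := min_le_left (c.1 - a.1) (c.2 - a.2)
    have hr := min_le_right (c.1 - a.1) (c.2 - a.2)
    set ε := min (c.1 - a.1) (c.2 - a.2)
    have h := (hmin (c.1 - ε, c.2 - ε) (by simp only; linarith)
      ⟨by simp only; linarith, by simp only; linarith⟩
      ⟨by simp only; linarith [hcb.1], by simp only; linarith [hcb.2]⟩).1
    simp only at h
    linarith
  rw [hd]
  rcases key with h | h
  · rw [abs_of_nonneg (by linarith)]; linarith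
  · rw [abs_of_nonpos (by linarith)]; linarith

/-- The greatest point of a diagonal line in a box lies on the upper boundary. -/
lemma abs_sub_eq_d1_of_greatest {a b c : ℝ × ℝ} {y₀ : ℝ} (hac : a ≤ c) (hcb : c ≤ b)
    (hc : c.1 - c.2 = y₀)
    (hmax : ∀ p : ℝ × ℝ, p.1 - p.2 = y₀ → a ≤ p → p ≤ b → p ≤ c) :
    |b.1 - b.2 - y₀| = d1 c b := by
  have h := abs_sub_eq_d1_of_least (a := -b) (b := -a) (c := -c) (y₀ := -y₀)
    (neg_le_neg hcb) (neg_le_neg hac) (by simp only [Prod.fst_neg, Prod.snd_neg]; linarith)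
    fun p hp hbp hpa => neg_le.1 <| hmax (-p)
      (by simp only [Prod.fst_neg, Prod.snd_neg]; linarith) (le_neg.1 hpa) (neg_le.1 hbp)
  rw [d1_of_le (neg_le_neg hcb), ← abs_neg] at h
  simp only [Prod.fst_neg, Prod.snd_neg] at h
  rw [d1_of_le hcb, show b.1 - b.2 - y₀ = -(-b.1 - -b.2 - -y₀) by ring, h]
  ring

/-- First case of the shortest-path lemma inside a parameter cell: if the monotone
free-space axis `L` crosses the rectangle `R` spanned by `a ≤ b`, with least and
greatest crossing points `c1 ≤ c2`, then the polyline `a → c1 → c2 → b` is a weighted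
shortest monotone path from `a` to `b`. -/
theorem shortest_path_in_cell_axis_crossing
    (u v cv : EuclideanSpace ℝ (Fin 2)) (hu : ‖u‖ = 1) (hv : ‖v‖ = 1)
    (huv : u + v ≠ 0)
    (w : ℝ × ℝ → ℝ) (hw : ∀ p : ℝ × ℝ, w p = ‖cv + p.1 • u - p.2 • v‖)
    (a b : ℝ × ℝ) (hab1 : a.1 ≤ b.1) (hab2 : a.2 ≤ b.2)
    (L R : Set (ℝ × ℝ))
    (hL : L = {p : ℝ × ℝ | ⟪cv + p.1 • u - p.2 • v, u + v⟫_ℝ = 0})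
    (hR : R = Set.Icc a b)
    (c1 c2 : ℝ × ℝ) (hc1 : c1 ∈ L ∩ R) (hc2 : c2 ∈ L ∩ R)
    (hc1min : ∀ p ∈ L ∩ R, c1 ≤ p) (hc2max : ∀ p ∈ L ∩ R, p ≤ c2)
    (ψ : ℝ → ℝ × ℝ) (K : NNReal) (hψ : LipschitzWith K ψ)
    (hm1 : MonotoneOn (fun t => (ψ t).1) (Set.Icc 0 1))
    (hm2 : MonotoneOn (fun t => (ψ t).2) (Set.Icc 0 1))
    (hψ0 : ψ 0 = a) (hψ1 : ψ 1 = b) :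
    ∫ t in (0:ℝ)..1,
        w (polyPath a c1 c2 b t) *
          (|(deriv (polyPath a c1 c2 b) t).1| + |(deriv (polyPath a c1 c2 b) t).2|)
      ≤ ∫ t in (0:ℝ)..1, w (ψ t) * (|(deriv ψ t).1| + |(deriv ψ t).2|) := by
  obtain ⟨η, hη⟩ : ∃ η, η = 1 + ⟪u, v⟫_ℝ := ⟨_, rfl⟩
  have hnorm : ‖u + v‖ ^ 2 = 2 * η := by
    rw [norm_add_sq_real, hu, hv, hη]
    ring
  have hηpos : 0 < η := by
    have := pow_pos (norm_pos_iff.2 huv) 2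
    linarith
  obtain ⟨y₀, hy₀⟩ : ∃ y₀, y₀ = -⟪cv, u + v⟫_ℝ / η := ⟨_, rfl⟩
  have hinner : ∀ p : ℝ × ℝ,
      ⟪cv + p.1 • u - p.2 • v, u + v⟫_ℝ = η * (p.1 - p.2 - y₀) := by
    intro p
    have hy : η * y₀ = -⟪cv, u + v⟫_ℝ := by rw [hy₀]; field_simp
    rw [inner_sub_left, inner_add_left, inner_smul_left, inner_smul_left, inner_add_right u,
      inner_add_right v, real_inner_self_eq_norm_sq, real_inner_self_eq_norm_sq, hu, hv,
      real_inner_comm u v, mul_sub, hy, hη]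
    simp only [conj_trivial]
    ring
  have hwle : ∀ p q : ℝ × ℝ, p.1 + p.2 = q.1 + q.2 →
      |p.1 - p.2 - y₀| ≤ |q.1 - q.2 - y₀| → w p ≤ w q := by
    intro p q h1 h2
    rw [hw, hw]
    exact norm_leash_le_of_abs_le hηpos.le hnorm hinner h1 h2
  have hwc : Continuous w := by
    rw [funext hw]
    fun_prop
  have hLmem : ∀ p, p ∈ L ↔ p.1 - p.2 = y₀ := by
    intro p
    rw [hL, Set.mem_ofPred_eq, hinner, mul_eq_zero, or_iff_right hηpos.ne', sub_eq_zero]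
  subst hR
  have hy1 := (hLmem c1).1 hc1.1
  have hy2 := (hLmem c2).1 hc2.1
  have ha := abs_sub_eq_d1_of_least hc1.2.1 hc1.2.2 hy1
    fun p h1 h2 h3 => hc1min p ⟨(hLmem p).2 h1, h2, h3⟩
  have hb := abs_sub_eq_d1_of_greatest hc2.2.1 hc2.2.2 hy2
    fun p h1 h2 h3 => hc2max p ⟨(hLmem p).2 h1, h2, h3⟩
  have h12 : c1 ≤ c2 := hc1min c2 hc2
  let m : ℝ → ℝ := fun x =>
    w ((x + (y₀ + axisGap a b y₀ x)) / 2, (x - (y₀ + axisGap a b y₀ x)) / 2)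
  have hgapc : Continuous (axisGap a b y₀) := by
    unfold axisGap
    fun_prop
  have hm : Continuous m := by fun_prop
  have habs : ∀ x, |(x + (y₀ + axisGap a b y₀ x)) / 2 - (x - (y₀ + axisGap a b y₀ x)) / 2 - y₀|
      = axisGap a b y₀ x := by
    intro x
    rw [show (x + (y₀ + axisGap a b y₀ x)) / 2 - (x - (y₀ + axisGap a b y₀ x)) / 2 - y₀
      = axisGap a b y₀ x by ring]
    exact abs_of_nonneg (le_max_left _ _)
  have hm_le : ∀ p, a ≤ p → p ≤ b → m (p.1 + p.2) ≤ w p := fun p h1 h2 =>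
    hwle _ _ (by simp only; ring) ((habs _).trans_le (axisGap_le y₀ h1 h2))
  have hle_m : ∀ t ∈ Set.Ioo (0 : ℝ) 1,
      w (polyPath a c1 c2 b t) ≤ m (a.1 + a.2 + t * (b.1 + b.2 - (a.1 + a.2))) := by
    intro t ht
    obtain ⟨h1, h2⟩ := polyPath_sum_and_abs_le hc1.2.1 h12 hc2.2.2 hy1 hy2 ha hb ht.1.le ht.2.le
    exact hwle _ _ (h1.trans (by simp only; ring)) (h2.trans_eq (habs _).symm)
  have hx : LipschitzWith (K + K) fun t => (ψ t).1 + (ψ t).2 :=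
    (LipschitzWith.prod_fst.comp hψ |>.weaken (by simp)).add
      (LipschitzWith.prod_snd.comp hψ |>.weaken (by simp))
  have hspeed := ae_abs_deriv_add_abs_deriv_eq hψ hm1 hm2
  have hψint : ∀ f : ℝ → ℝ, Continuous f → IntervalIntegrable
      (fun t => f t * deriv (fun t => (ψ t).1 + (ψ t).2) t) volume 0 1 := fun f hf =>
    hx.lipschitzOnWith.absolutelyContinuousOnInterval.intervalIntegrable_deriv.continuousOn_mul
      hf.continuousOn
  have hσ : ∀ t, HasDerivAt (fun t : ℝ => a.1 + a.2 + t * (b.1 + b.2 - (a.1 + a.2)))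
      (b.1 + b.2 - (a.1 + a.2)) t := fun t => by
    simpa using ((hasDerivAt_id t).mul_const (b.1 + b.2 - (a.1 + a.2))).const_add (a.1 + a.2)
  have hl : d1 a c1 + d1 c1 c2 + d1 c2 b = b.1 + b.2 - (a.1 + a.2) := by
    rw [d1_of_le hc1.2.1, d1_of_le h12, d1_of_le hc2.2.2]
    ring
  have hw0 : ∀ p, 0 ≤ w p := fun p => by
    rw [hw]
    exact norm_nonneg _
  have hsub : ∫ t in (0 : ℝ)..1, m (a.1 + a.2 + t * (b.1 + b.2 - (a.1 + a.2))) *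
        (b.1 + b.2 - (a.1 + a.2)) =
      ∫ t in (0 : ℝ)..1, m ((ψ t).1 + (ψ t).2) * deriv (fun t => (ψ t).1 + (ψ t).2) t := by
    rw [integral_comp_mul_deriv_of_lipschitzWith hm hx, hψ0, hψ1]
    refine (intervalIntegral.integral_comp_mul_deriv (fun t _ => hσ t) continuousOn_const
      hm).trans ?_
    congr 1 <;> ring
  calc
    _ ≤ ∫ t in (0 : ℝ)..1, m (a.1 + a.2 + t * (b.1 + b.2 - (a.1 + a.2))) *
          (b.1 + b.2 - (a.1 + a.2)) := by
      refine integral_mono_of_ae_Ioo zero_le_one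
        (Continuous.intervalIntegrable (by fun_prop) _ _) ?_
      filter_upwards [ae_abs_deriv_polyPath a c1 c2 b] with t ht hmem
      have hpos : 0 ≤ b.1 + b.2 - (a.1 + a.2) := by linarith
      rw [ht hmem, hl]
      exact ⟨mul_nonneg (hw0 _) hpos, mul_le_mul_of_nonneg_right (hle_m t hmem) hpos⟩
    _ = _ := hsub
    _ ≤ ∫ t in (0 : ℝ)..1, w (ψ t) * deriv (fun t => (ψ t).1 + (ψ t).2) t := by
      refine integral_mono_of_ae_Ioo zero_le_one (hψint _ (hwc.comp hψ.continuous)) ?_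
      filter_upwards [hspeed] with t ht hmem
      have hpos := (ht hmem).2
      have hIcc := Set.Ioo_subset_Icc_self hmem
      have hl0 : (0 : ℝ) ∈ Set.Icc (0 : ℝ) 1 := ⟨le_rfl, zero_le_one⟩
      have hl1 : (1 : ℝ) ∈ Set.Icc (0 : ℝ) 1 := ⟨zero_le_one, le_rfl⟩
      have haψ : a ≤ ψ t := by
        rw [← hψ0]
        exact ⟨hm1 hl0 hIcc hmem.1.le, hm2 hl0 hIcc hmem.1.le⟩
      have hψb : ψ t ≤ b := by
        rw [← hψ1]
        exact ⟨hm1 hIcc hl1 hmem.2.le, hm2 hIcc hl1 hmem.2.le⟩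
      exact ⟨mul_nonneg (hw0 _) hpos, mul_le_mul_of_nonneg_right (hm_le _ haψ hψb) hpos⟩
    _ = _ := by
      rw [intervalIntegral.integral_of_le zero_le_one, intervalIntegral.integral_of_le zero_le_one,
        integral_Ioc_eq_integral_Ioo, integral_Ioc_eq_integral_Ioo]
      refine setIntegral_congr_ae measurableSet_Ioo ?_
      filter_upwards [hspeed] with t ht hmem
      rw [(ht hmem).1]
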